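/- arXiv:math/0212241 — 2 statements merged into one kernel-verified Lean document; each statement's English description precedes it below -/
import Mathlib

section
/- Let E be a directed graph. Define d_s : E^0 ∪ E^1 → ℕ ∪ {∞} as follows: if v ∈ E^0 has infinite valency, fix an enumeration s^{-1}(v) = {e_0, e_1, e_2, …} and set d_s(v) = ∞ and d_s(e_i) = i; if v is a sink set d_s(v) = ∞; if v emits at least one and only finitely many edges set d_s(v) = 0 (and hence d_s(e) = 0 for every e ∈ s^{-1}(v)). Then d_s is a strictly proper Drinen source-vector for E, and the out-delayed graph d_s(E) is row-finite (every vertex emits only finitely many edges) and has no sinks. -/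
/-! Statement 13: the Drinen–Tomforde desingularisation out-delay is a strictly proper
Drinen source-vector whose out-delayed graph is row-finite with no sinks. -/

section OutDelay

variable {V E : Type} (r s : E → V) (d : V → ℕ∞) (dE : E → ℕ)

/-- Vertices of the out-delayed graph `d_s(E)`: pairs `v^i = (v, i)` with
`0 ≤ i ≤ d_s v`. -/
def ODVert : Type := {p : V × ℕ // (p.2 : ℕ∞) ≤ d p.1}

/-- Edges of the out-delayed graph: the original edges `e ∈ E^1` together with the
delay edges `f(v)^i`, `1 ≤ i ≤ d_s v`, encoded as pairs `(v, i)`. -/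
def ODEdge (E : Type) {V : Type} (d : V → ℕ∞) : Type :=
  E ⊕ {p : V × ℕ // 1 ≤ p.2 ∧ (p.2 : ℕ∞) ≤ d p.1}

/-- The source map of the out-delayed graph: `s(e) = s(e)^{d_s e}` and
`s(f(v)^i) = v^{i-1}`. -/
def odSrc (hsd : ∀ e, (dE e : ℕ∞) ≤ d (s e)) : ODEdge E d → ODVert d
  | .inl e => ⟨(s e, dE e), hsd e⟩
  | .inr g => ⟨(g.1.1, g.1.2 - 1), le_trans (by exact_mod_cast Nat.sub_le _ _) g.2.2⟩

/-- The range map of the out-delayed graph: `r(e) = r(e)^0` and `r(f(v)^i) = v^i`. -/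
def odRng : ODEdge E d → ODVert d
  | .inl e => ⟨(r e, 0), by simp⟩
  | .inr g => ⟨g.1, g.2.2⟩

end OutDelay

section Desing

variable {V E : Type} (s : E → V) (num : E → ℕ)

open scoped Classical in
/-- The vertex part of the desingularising Drinen source-vector: `d_s v = ∞` if `v` is
a sink or has infinite valency, and `d_s v = 0` if `v` emits at least one and only
finitely many edges. -/
noncomputable def desingD (v : V) : ℕ∞ :=
  if {e | s e = v} = ∅ then ⊤ else if {e | s e = v}.Infinite then ⊤ else 0

open scoped Classical in
/-- The edge part of the desingularising Drinen source-vector: `d_s eᵢ = i` (via the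
chosen enumeration `num` of `s⁻¹(v)`) when `s e` has infinite valency, and `d_s e = 0`
otherwise. -/
noncomputable def desingDE (e : E) : ℕ :=
  if {e' | s e' = s e}.Infinite then num e else 0

end Desing

section DesingLemmas

variable {V E : Type} (s : E → V) (num : E → ℕ)

lemma desingD_of_infinite {v : V} (h : {e | s e = v}.Infinite) : desingD s v = ⊤ := by
  simp [desingD, h]

lemma desingD_of_finite {v : V} (hne : {e | s e = v}.Nonempty) (h : ¬ {e | s e = v}.Infinite) :
    desingD s v = 0 := by
  rw [desingD, if_neg hne.ne_empty, if_neg h]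

lemma desingD_of_empty {v : V} (h : {e | s e = v} = ∅) : desingD s v = ⊤ := by
  rw [desingD, if_pos h]

lemma desingDE_of_infinite {v : V} {e : E} (he : s e = v) (h : {e | s e = v}.Infinite) :
    desingDE s num e = num e := by
  subst he
  rw [desingDE, if_pos h]

lemma desingDE_of_finite {v : V} {e : E} (he : s e = v) (h : ¬ {e | s e = v}.Infinite) :
    desingDE s num e = 0 := by
  subst he
  rw [desingDE, if_neg h]

lemma desingD_eq_iSup
    (hnum : ∀ v, {e | s e = v}.Infinite → Set.BijOn num {e | s e = v} Set.univ)
    (v : V) (hne : {e | s e = v}.Nonempty) :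
    desingD s v = ⨆ e : {e // s e = v}, (desingDE s num e.1 : ℕ∞) := by
  by_cases h : {e | s e = v}.Infinite
  · rw [desingD_of_infinite s h, eq_comm, ENat.eq_top_iff_forall_ge]
    intro n
    obtain ⟨e, he, rfl⟩ := (hnum v h).surjOn (Set.mem_univ n)
    refine le_trans ?_ (le_iSup (fun e : {e // s e = v} => (desingDE s num e.1 : ℕ∞)) ⟨e, he⟩)
    simp [desingDE_of_infinite s num he h]
  · rw [desingD_of_finite s hne h, eq_comm, ← nonpos_iff_eq_zero]
    refine iSup_le fun e => ?_
    simp [desingDE_of_finite s num e.2 h]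

lemma desingD_eq_top {v : V} (hv : desingD s v = ⊤) :
    {e | s e = v} = ∅ ∨ {e | s e = v}.Infinite := by
  by_contra! h
  rw [desingD_of_finite s h.1 (Set.not_infinite.mpr (by simpa using h.2))] at hv
  exact absurd hv (by simp)

variable (hsd : ∀ e, (desingDE s num e : ℕ∞) ≤ desingD s (s e))

lemma finite_edges_desingDE_eq
    (hnum : ∀ v, {e | s e = v}.Infinite → Set.BijOn num {e | s e = v} Set.univ)
    (v : V) (i : ℕ) : {e | s e = v ∧ desingDE s num e = i}.Finite := by
  by_cases h : {e | s e = v}.Infinite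
  · refine Set.Subsingleton.finite fun a ha b hb => (hnum v h).injOn ha.1 hb.1 ?_
    rw [← desingDE_of_infinite s num ha.1 h, ← desingDE_of_infinite s num hb.1 h, ha.2, hb.2]
  · exact (Set.not_infinite.mp h).subset fun e he => he.1

lemma finite_odSrc_fiber
    (hnum : ∀ v, {e | s e = v}.Infinite → Set.BijOn num {e | s e = v} Set.univ)
    (w : ODVert (desingD s)) :
    {g : ODEdge E (desingD s) | odSrc s (desingD s) (desingDE s num) hsd g = w}.Finite := by
  obtain ⟨⟨v, i⟩, hw⟩ := w
  have hdelay : {p : {p : V × ℕ // 1 ≤ p.2 ∧ (p.2 : ℕ∞) ≤ desingD s p.1} |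
      p.1 = (v, i + 1)}.Finite :=
    Set.Subsingleton.finite fun a ha b hb => Subtype.ext (ha.trans hb.symm)
  refine (((finite_edges_desingDE_eq s num hnum v i).image Sum.inl).union
    (hdelay.image Sum.inr)).subset ?_
  rintro (e | ⟨⟨u, j⟩, hj, hju⟩) hg
  · have h := congrArg Subtype.val hg
    simp only [odSrc, Prod.mk.injEq] at h
    exact Or.inl ⟨e, h, rfl⟩
  · have h := congrArg Subtype.val hg
    simp only [odSrc, Prod.mk.injEq] at h
    refine Or.inr ⟨_, ?_, rfl⟩
    simp only [Set.mem_ofPred_eq, Prod.mk.injEq]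
    exact ⟨h.1, by simp only at hj; omega⟩

lemma exists_odSrc_eq (w : ODVert (desingD s)) :
    ∃ g : ODEdge E (desingD s), odSrc s (desingD s) (desingDE s num) hsd g = w := by
  obtain ⟨⟨v, i⟩, hw⟩ := w
  by_cases htop : desingD s v = ⊤
  · exact ⟨Sum.inr ⟨(v, i + 1), by simp, by simp [htop]⟩, Subtype.ext (by simp [odSrc])⟩
  · have hne : {e | s e = v}.Nonempty :=
      Set.nonempty_iff_ne_empty.mpr fun h => htop (desingD_of_empty s h)
    have hfin : ¬ {e | s e = v}.Infinite := fun h => htop (desingD_of_infinite s h)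
    obtain ⟨e, he⟩ := hne
    have hi : i = 0 := by
      simpa [desingD_of_finite s ⟨e, he⟩ hfin] using hw
    exact ⟨Sum.inl e, Subtype.ext (Prod.ext he ((desingDE_of_finite s num he hfin).trans hi.symm))⟩

end DesingLemmas

/-- Let `E` be a directed graph (countable vertex and edge sets).
For each vertex of infinite valency fix an enumeration `s⁻¹(v) = {e_0, e_1, …}` (the
function `num`, a bijection from `s⁻¹(v)` onto `ℕ` at every such `v`), and define
`d_s` by: `d_s v = ∞` and `d_s e_i = i` at vertices of infinite valency, `d_s v = ∞` at
sinks, and `d_s v = 0` (hence `d_s e = 0` for `e ∈ s⁻¹(v)`) at vertices of finite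
nonzero valency.  Then `d_s` is a strictly proper Drinen source-vector for `E`, and the
out-delayed graph `d_s(E)` is row-finite and has no sinks. -/
theorem desingularisation_works
    {V E : Type} [Countable V] [Countable E] (r s : E → V) (num : E → ℕ)
    (hnum : ∀ v, {e | s e = v}.Infinite →
      Set.BijOn num {e | s e = v} Set.univ) :
    -- `d_s` is a Drinen source-vector:
    ((∀ v, {e | s e = v}.Nonempty →
        desingD s v = ⨆ e : {e // s e = v}, (desingDE s num e.1 : ℕ∞)) ∧
      (∀ v, desingD s v = ⊤ →
        ({e | s e = v} = ∅ ∨ {e | s e = v}.Infinite))) ∧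
    -- and, with `hsd` the resulting bound `d_s e ≤ d_s (s e)`:
    ∀ hsd : ∀ e, ((desingDE s num e : ℕ∞) ≤ desingD s (s e)),
      -- `d_s` is strictly proper,
      (∀ v, {e | s e = v}.Infinite → ∀ w : ODVert (desingD s), w.1.1 = v →
        {g : ODEdge E (desingD s) |
          odSrc s (desingD s) (desingDE s num) hsd g = w}.Infinite →
        (w.1.2 : ℕ∞) = desingD s v) ∧
      -- the out-delayed graph is row-finite,
      (∀ w : ODVert (desingD s),
        {g : ODEdge E (desingD s) |
          odSrc s (desingD s) (desingDE s num) hsd g = w}.Finite) ∧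
      -- and the out-delayed graph has no sinks.
      (∀ w : ODVert (desingD s),
        ∃ g : ODEdge E (desingD s),
          odSrc s (desingD s) (desingDE s num) hsd g = w) := by
  exact ⟨⟨desingD_eq_iSup s num hnum, fun _ => desingD_eq_top s⟩, fun hsd =>
    ⟨fun _ _ w _ hw => absurd (finite_odSrc_fiber s num hsd hnum w) hw,
      finite_odSrc_fiber s num hsd hnum, exists_odSrc_eq s num hsd⟩⟩
end

section
/- Let E be a row-finite directed graph. Define d_r : E^0 ∪ E^1 → ℕ ∪ {∞} as follows: if v ∈ E^0 receives infinitely many edges, fix an enumeration r^{-1}(v) = {e_0, e_1, e_2, …} and set d_r(v) = ∞ and d_r(e_i) = i; if v is a source set d_r(v) = ∞; if v receives at least one and only finitely many edges set d_r(v) = 0 (and hence d_r(e) = 0 for every e ∈ r^{-1}(v)). Then d_r is a Drinen range-vector for E, and the in-delayed graph d_r(E) is locally finite (every vertex emits only finitely many edges and receives only finitely many edges) and has no sources. -/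
/-! Statement 14: for a row-finite graph, the in-delay which enumerates the edges into
each infinite receiver is a Drinen range-vector whose in-delayed graph is locally
finite with no sources. -/

section InDelay

variable {V E : Type} (r s : E → V) (d : V → ℕ∞) (dE : E → ℕ)

/-- Vertices of the in-delayed graph `d_r(E)`: pairs `v_i = (v, i)` with
`0 ≤ i ≤ d_r v`. -/
def IDVert : Type := {p : V × ℕ // (p.2 : ℕ∞) ≤ d p.1}

/-- Edges of the in-delayed graph: the original edges `e ∈ E^1` together with the
delay edges `f(v)_i`, `1 ≤ i ≤ d_r v`, encoded as pairs `(v, i)`. -/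
def IDEdge (E : Type) {V : Type} (d : V → ℕ∞) : Type :=
  E ⊕ {p : V × ℕ // 1 ≤ p.2 ∧ (p.2 : ℕ∞) ≤ d p.1}

/-- The source map of the in-delayed graph: `s(e) = s(e)_0` and `s(f(v)_i) = v_i`. -/
def idSrc : IDEdge E d → IDVert d
  | .inl e => ⟨(s e, 0), by simp⟩
  | .inr g => ⟨g.1, g.2.2⟩

/-- The range map of the in-delayed graph: `r(e) = r(e)_{d_r e}` and
`r(f(v)_i) = v_{i-1}`. -/
def idRng (hrd : ∀ e, (dE e : ℕ∞) ≤ d (r e)) : IDEdge E d → IDVert d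
  | .inl e => ⟨(r e, dE e), hrd e⟩
  | .inr g => ⟨(g.1.1, g.1.2 - 1), le_trans (by exact_mod_cast Nat.sub_le _ _) g.2.2⟩

end InDelay

section LocFin

variable {V E : Type} (r : E → V) (num : E → ℕ)

open scoped Classical in
/-- The vertex part of the Drinen range-vector: `d_r v = ∞` if `v` is a source or
receives infinitely many edges, and `d_r v = 0` if `v` receives at least one and only
finitely many edges. -/
noncomputable def locfinD (v : V) : ℕ∞ :=
  if {e | r e = v} = ∅ then ⊤ else if {e | r e = v}.Infinite then ⊤ else 0

open scoped Classical in
/-- The edge part of the Drinen range-vector: `d_r eᵢ = i` (via the chosen enumeration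
`num` of `r⁻¹(v)`) when `r e` receives infinitely many edges, and `d_r e = 0`
otherwise. -/
noncomputable def locfinDE (e : E) : ℕ :=
  if {e' | r e' = r e}.Infinite then num e else 0

end LocFin

section Aux

variable {V E : Type} {r : E → V} {num : E → ℕ}

theorem locfinD_eq_top_iff {v : V} :
    locfinD r v = ⊤ ↔ {e | r e = v} = ∅ ∨ {e | r e = v}.Infinite := by
  unfold locfinD
  split_ifs with h₁ h₂ <;> simp [*]

theorem locfinD_eq_zero {v : V} (hne : {e | r e = v}.Nonempty)
    (hfin : {e | r e = v}.Finite) : locfinD r v = 0 := by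
  simp [locfinD, hne.ne_empty, Set.not_infinite.mpr hfin]

theorem locfinDE_of_infinite {v : V} (hinf : {e | r e = v}.Infinite) {e : E} (he : r e = v) :
    locfinDE r num e = num e := by
  subst he
  exact if_pos hinf

theorem locfinDE_of_finite {v : V} (hfin : {e | r e = v}.Finite) {e : E} (he : r e = v) :
    locfinDE r num e = 0 := by
  subst he
  exact if_neg (Set.not_infinite.mpr hfin)

theorem locfinD_eq_iSup
    (hsurj : ∀ v, {e | r e = v}.Infinite → Set.SurjOn num {e | r e = v} Set.univ)
    {v : V} (hne : {e | r e = v}.Nonempty) :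
    locfinD r v = ⨆ e : {e // r e = v}, (locfinDE r num e.1 : ℕ∞) := by
  by_cases hinf : {e | r e = v}.Infinite
  · rw [locfinD_eq_top_iff.mpr (.inr hinf), eq_comm, ENat.eq_top_iff_forall_ge]
    intro m
    obtain ⟨e, he, rfl⟩ := hsurj v hinf (Set.mem_univ m)
    exact le_iSup_of_le ⟨e, he⟩ (by rw [locfinDE_of_infinite hinf he])
  · rw [Set.not_infinite] at hinf
    rw [locfinD_eq_zero hne hinf, eq_comm, ← bot_eq_zero, iSup_eq_bot]
    intro e
    rw [locfinDE_of_finite hinf e.2]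
    rfl

theorem finite_setOf_locfinDE_eq
    (hinj : ∀ v, {e | r e = v}.Infinite → Set.InjOn num {e | r e = v}) (v : V) (i : ℕ) :
    {e | r e = v ∧ locfinDE r num e = i}.Finite := by
  by_cases hinf : {e | r e = v}.Infinite
  · refine Set.Subsingleton.finite ?_
    rintro a ⟨ha, hai⟩ b ⟨hb, hbi⟩
    rw [locfinDE_of_infinite hinf ha] at hai
    rw [locfinDE_of_infinite hinf hb] at hbi
    exact hinj v hinf ha hb (hai.trans hbi.symm)
  · exact (Set.not_infinite.mp hinf).subset fun e he => he.1

variable {s : E → V} {d : V → ℕ∞} {dE : E → ℕ}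

theorem IDEdge.finite_of_preimage {S : Set (IDEdge E d)}
    (hl : (Sum.inl ⁻¹' S : Set E).Finite)
    (hr : (Sum.inr ⁻¹' S : Set {p : V × ℕ // 1 ≤ p.2 ∧ (p.2 : ℕ∞) ≤ d p.1}).Finite) :
    S.Finite := by
  refine ((hl.image Sum.inl).union (hr.image Sum.inr)).subset ?_
  rintro (e | g) h
  · exact .inl ⟨e, h, rfl⟩
  · exact .inr ⟨g, h, rfl⟩

theorem finite_setOf_idSrc_eq (hs : ∀ v, {e | s e = v}.Finite) (w : IDVert d) :
    {g : IDEdge E d | idSrc s d g = w}.Finite := by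
  apply IDEdge.finite_of_preimage
  · exact (hs w.1.1).subset fun e he => congrArg (fun x : IDVert d => x.1.1) he
  · refine Set.Subsingleton.finite fun a ha b hb => Subtype.ext ?_
    exact congrArg (fun x : IDVert d => x.1) (Eq.trans ha (Eq.symm hb))

theorem finite_setOf_idRng_eq (hrd : ∀ e, (dE e : ℕ∞) ≤ d (r e))
    (hfin : ∀ v i, {e | r e = v ∧ dE e = i}.Finite) (w : IDVert d) :
    {g : IDEdge E d | idRng r d dE hrd g = w}.Finite := by
  apply IDEdge.finite_of_preimage
  · exact (hfin w.1.1 w.1.2).subset fun e he =>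
      ⟨congrArg (fun x : IDVert d => x.1.1) he, congrArg (fun x : IDVert d => x.1.2) he⟩
  · refine Set.Subsingleton.finite fun a ha b hb => Subtype.ext ?_
    have hab := Eq.trans ha (Eq.symm hb)
    have h₁ : a.1.1 = b.1.1 := congrArg (fun x : IDVert d => x.1.1) hab
    have h₂ : a.1.2 - 1 = b.1.2 - 1 := congrArg (fun x : IDVert d => x.1.2) hab
    have ha₁ := a.2.1
    have hb₁ := b.2.1
    exact Prod.ext h₁ (by omega)

theorem exists_idRng_locfin_eq (hrd : ∀ e, (locfinDE r num e : ℕ∞) ≤ locfinD r (r e))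
    (w : IDVert (locfinD r)) :
    ∃ g : IDEdge E (locfinD r), idRng r (locfinD r) (locfinDE r num) hrd g = w := by
  obtain ⟨⟨v, i⟩, hi⟩ := w
  by_cases htop : locfinD r v = ⊤
  · exact ⟨.inr ⟨(v, i + 1), Nat.le_add_left 1 i, by simp [htop]⟩, rfl⟩
  · have h := locfinD_eq_top_iff.not.mp htop
    rw [not_or, Set.not_infinite, ← Ne, ← Set.nonempty_iff_ne_empty] at h
    obtain ⟨⟨e, he⟩, hfin⟩ := h
    have hi₀ : i = 0 := by simpa [locfinD_eq_zero ⟨e, he⟩ hfin] using hi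
    exact ⟨.inl e, Subtype.ext (Prod.ext he ((locfinDE_of_finite hfin he).trans hi₀.symm))⟩

end Aux

/-- Let `E` be a row-finite directed graph (countable vertex and
edge sets).  For each vertex receiving infinitely many edges fix an enumeration
`r⁻¹(v) = {e_0, e_1, …}` (the function `num`, a bijection from `r⁻¹(v)` onto `ℕ` at
every such `v`), and define `d_r` by: `d_r v = ∞` and `d_r e_i = i` at infinite
receivers, `d_r v = ∞` at sources, and `d_r v = 0` (hence `d_r e = 0` for
`e ∈ r⁻¹(v)`) at vertices receiving at least one and only finitely many edges.  Then
`d_r` is a Drinen range-vector for `E`, and the in-delayed graph `d_r(E)` is locally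
finite (every vertex emits and receives only finitely many edges) and has no
sources. -/
theorem indelay_locally_finite
    {V E : Type} [Countable V] [Countable E] (r s : E → V)
    (hrowfin : ∀ v, {e | s e = v}.Finite)
    (num : E → ℕ)
    (hnum : ∀ v, {e | r e = v}.Infinite →
      Set.BijOn num {e | r e = v} Set.univ) :
    -- `d_r` is a Drinen range-vector:
    ((∀ v, {e | r e = v}.Nonempty →
        locfinD r v = ⨆ e : {e // r e = v}, (locfinDE r num e.1 : ℕ∞)) ∧
      (∀ v, locfinD r v = ⊤ →
        ({e | r e = v} = ∅ ∨ {e | r e = v}.Infinite))) ∧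
    -- and, with `hrd` the resulting bound `d_r e ≤ d_r (r e)`:
    ∀ hrd : ∀ e, ((locfinDE r num e : ℕ∞) ≤ locfinD r (r e)),
      -- every vertex of the in-delayed graph emits finitely many edges,
      (∀ w : IDVert (locfinD r),
        {g : IDEdge E (locfinD r) | idSrc s (locfinD r) g = w}.Finite) ∧
      -- every vertex of the in-delayed graph receives finitely many edges,
      (∀ w : IDVert (locfinD r),
        {g : IDEdge E (locfinD r) |
          idRng r (locfinD r) (locfinDE r num) hrd g = w}.Finite) ∧
      -- and the in-delayed graph has no sources.
      (∀ w : IDVert (locfinD r),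
        ∃ g : IDEdge E (locfinD r),
          idRng r (locfinD r) (locfinDE r num) hrd g = w) := by
  refine ⟨⟨fun v hne => locfinD_eq_iSup (fun v hv => (hnum v hv).surjOn) hne,
    fun v => locfinD_eq_top_iff.mp⟩, fun hrd => ⟨finite_setOf_idSrc_eq hrowfin, ?_,
    exists_idRng_locfin_eq hrd⟩⟩
  exact finite_setOf_idRng_eq hrd (finite_setOf_locfinDE_eq fun v hv => (hnum v hv).injOn)
end
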